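/- Let A and B be locally small categories such that A has all small colimits, and let f : A ⥤ B be a functor that preserves all small colimits. Then f satisfies the solution set condition if and only if f is small-admissible. -/

import Mathlib

open CategoryTheory CategoryTheory.Limits

universe v u₁ u₂

/-- A functor `f : A ⥤ B` satisfies the solution set condition if for every `b : B` there is a
small family of objects `a i` of `A` and morphisms `g i : f.obj (a i) ⟶ b` through which every
morphism `f.obj x ⟶ b` factors. -/
def SolutionSetCondition {A : Type u₁} {B : Type u₂} [Category.{v} A] [Category.{v} B]
    (f : A ⥤ B) : Prop :=
  ∀ b : B, ∃ (ι : Type v) (a : ι → A) (g : ∀ i : ι, f.obj (a i) ⟶ b),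
    ∀ (x : A) (h : f.obj x ⟶ b), ∃ (i : ι) (t : x ⟶ a i), f.map t ≫ g i = h

/-- A functor `f : A ⥤ B` is small-admissible if, for every `b : B`, the presheaf
`B(f(−), b) = f.op ⋙ yoneda.obj b : Aᵒᵖ ⥤ Type v` is a small colimit of representables. -/
def SmallAdmissible {A : Type u₁} {B : Type u₂} [Category.{v} A] [Category.{v} B]
    (f : A ⥤ B) : Prop :=
  ∀ b : B, ∃ (J : Type v) (_ : SmallCategory J) (G : J ⥤ A),
    Nonempty ((f.op ⋙ yoneda.obj b) ≅ colimit (G ⋙ yoneda))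

/-- The **dual general adjoint functor theorem**: a functor which preserves small colimits, whose
domain has small colimits and which satisfies the solution set condition is a left adjoint. -/
theorem SolutionSetCondition.isLeftAdjoint {A : Type u₁} {B : Type u₂}
    [Category.{v} A] [Category.{v} B] [HasColimitsOfSize.{v, v} A]
    {f : A ⥤ B} [PreservesColimitsOfSize.{v, v} f] (hf : _root_.SolutionSetCondition f) :
    f.IsLeftAdjoint := by
  have hop : CategoryTheory.SolutionSetCondition.{v} f.op := by
    intro b
    obtain ⟨ι, a, g, hg⟩ := hf b.unop
    refine ⟨ι, fun i => .op (a i), fun i => (g i).op, fun x h => ?_⟩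
    obtain ⟨i, t, ht⟩ := hg x.unop h.unop
    exact ⟨i, t.op, Quiver.Hom.unop_inj ht⟩
  have : PreservesLimitsOfSize.{v, v} f.op := preservesLimitsOfSize_op f
  have := isRightAdjoint_of_preservesLimits_of_solutionSetCondition f.op hop
  exact (Adjunction.ofIsRightAdjoint f.op).unop.isLeftAdjoint

/-- A left adjoint is small-admissible, since the presheaves `B(f(−), b)` are representable. -/
theorem SmallAdmissible.of_isLeftAdjoint {A : Type u₁} {B : Type u₂}
    [Category.{v} A] [Category.{v} B] (f : A ⥤ B) [f.IsLeftAdjoint] : SmallAdmissible f := by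
  intro b
  let a := f.rightAdjoint.obj b
  have e : yoneda.obj a ≅ f.op ⋙ yoneda.obj b :=
    ((Adjunction.ofIsLeftAdjoint f).representableBy b).toIso
  refine ⟨Discrete PUnit.{v + 1}, inferInstance, (Functor.const _).obj a, ⟨e.symm ≪≫ ?_⟩⟩
  exact (isColimitConstCocone (Discrete PUnit.{v + 1}) (yoneda.obj a)).coconePointsIsoOfNatIso
    (colimit.isColimit _) (Functor.constComp _ a yoneda).symm

/-- A small-admissible functor satisfies the solution set condition: the objects of a diagram of
representables with colimit `B(f(−), b)` form a solution set at `b`. -/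
theorem SmallAdmissible.solutionSetCondition {A : Type u₁} {B : Type u₂}
    [Category.{v} A] [Category.{v} B] {f : A ⥤ B} (hf : SmallAdmissible f) :
    _root_.SolutionSetCondition f := by
  intro b
  obtain ⟨J, _, G, ⟨e⟩⟩ := hf b
  let φ (j : J) : yoneda.obj (G.obj j) ⟶ f.op ⋙ yoneda.obj b :=
    colimit.ι (G ⋙ yoneda) j ≫ e.inv
  refine ⟨J, G.obj, fun j => yonedaEquiv (φ j), fun x h => ?_⟩
  obtain ⟨j, t, ht⟩ := Types.jointly_surjective _
    (isColimitOfPreserves ((evaluation _ _).obj (.op x)) (colimit.isColimit (G ⋙ yoneda)))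
    (e.hom.app (.op x) h)
  change x ⟶ G.obj j at t
  have hφ : (φ j).app (.op x) t = h := by
    change e.inv.app _ ((colimit.ι (G ⋙ yoneda) j).app _ t) = h
    erw [ht]
    simp
  exact ⟨j, t, (yonedaEquiv_naturality (φ j) t).trans (.trans (by rw [yonedaEquiv_apply]; simp) hφ)⟩

/-- A small-cocontinuous functor from a small-cocomplete category satisfies the solution set
condition iff it is small-admissible. -/
theorem solutionSetCondition_iff_smallAdmissible {A : Type u₁} {B : Type u₂}
    [Category.{v} A] [Category.{v} B] [HasColimitsOfSize.{v, v} A]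
    (f : A ⥤ B) [PreservesColimitsOfSize.{v, v} f] :
    _root_.SolutionSetCondition f ↔ SmallAdmissible f := by
  refine ⟨fun hf => ?_, SmallAdmissible.solutionSetCondition⟩
  have := hf.isLeftAdjoint
  exact SmallAdmissible.of_isLeftAdjoint f
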